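/- Let k, n ≥ 1 and let S_{i,j} ⊆ {1,…,n}×{1,…,n} be nonempty for all i, j ∈ {1,…,k}. Suppose B' ⊆ B has |B'| = k², every voter position has a unique nearest box in B', and red wins at every box of B'. Then for every i, j ∈ {1,…,k}, B' contains exactly one box from B_{i,j}; the voters voting at this box are exactly the voters at the five positions c^{i,j}, V_←^{i,j}, V_→^{i,j}, V_↑^{i,j}, V_↓^{i,j}; and the pairs s_{i,j} ∈ S_{i,j} determined by these selected boxes form a grid-tiling solution. -/

import Mathlib

open scoped Classical

noncomputable section

/-- Euclidean distance between two points of the plane `ℝ × ℝ`. -/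
def edist2 (a b : ℝ × ℝ) : ℝ := Real.sqrt ((a.1 - b.1) ^ 2 + (a.2 - b.2) ^ 2)

/-- The grid scale `L = 10n² + 4n`. -/
def Lc (n : ℕ) : ℝ := 10 * (n : ℝ) ^ 2 + 4 * (n : ℝ)

/-- The ballot box `b^{i,j}_{(p,q)}`. -/
def bbox (n i j p q : ℕ) : ℝ × ℝ :=
  ((if Even i then Lc n * ((i : ℝ) - 1) + 5 * (n : ℝ) ^ 2 + 4 * (p : ℝ)
    else Lc n * ((i : ℝ) - 1) + 5 * (n : ℝ) ^ 2 + 4 * ((n : ℝ) - (p : ℝ))),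
   (if Even j then Lc n * ((j : ℝ) - 1) + 5 * (n : ℝ) ^ 2 + 4 * (q : ℝ)
    else Lc n * ((j : ℝ) - 1) + 5 * (n : ℝ) ^ 2 + 4 * ((n : ℝ) - (q : ℝ))))

/-- The voter position `V_←^{i,j}`. -/
def Vl (n i j : ℕ) : ℝ × ℝ :=
  (Lc n * ((i : ℝ) - 1) + 1, Lc n * ((j : ℝ) - 1) + 5 * (n : ℝ) ^ 2 + 2 * (n : ℝ))

/-- The voter position `V_→^{i,j}`. -/
def Vr (n i j : ℕ) : ℝ × ℝ :=
  (Lc n * (i : ℝ) - 1, Lc n * ((j : ℝ) - 1) + 5 * (n : ℝ) ^ 2 + 2 * (n : ℝ))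

/-- The voter position `V_↑^{i,j}`. -/
def Vu (n i j : ℕ) : ℝ × ℝ :=
  (Lc n * ((i : ℝ) - 1) + 5 * (n : ℝ) ^ 2 + 2 * (n : ℝ), Lc n * ((j : ℝ) - 1) + 1)

/-- The voter position `V_↓^{i,j}`. -/
def Vd (n i j : ℕ) : ℝ × ℝ :=
  (Lc n * ((i : ℝ) - 1) + 5 * (n : ℝ) ^ 2 + 2 * (n : ℝ), Lc n * (j : ℝ) - 1)

/-- The center position `c^{i,j}` where the red voters sit. -/
def cpos (n i j : ℕ) : ℝ × ℝ :=
  (Lc n * ((i : ℝ) - 1) + 5 * (n : ℝ) ^ 2 + 2 * (n : ℝ),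
   Lc n * ((j : ℝ) - 1) + 5 * (n : ℝ) ^ 2 + 2 * (n : ℝ))

/-- `b` is the (unique, strictly) nearest box of `B'` to the position `v`. -/
def nearestIn (B' : Set (ℝ × ℝ)) (v b : ℝ × ℝ) : Prop :=
  b ∈ B' ∧ ∀ b' ∈ B', b' ≠ b → edist2 v b < edist2 v b'

/-- The five voter positions of the cell `(i,j)`. -/
def fivePos (n i j : ℕ) : Set (ℝ × ℝ) :=
  {cpos n i j, Vl n i j, Vr n i j, Vu n i j, Vd n i j}

/-- All voter positions of the instance. -/
def allPositions (k n : ℕ) : Set (ℝ × ℝ) :=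
  {v | ∃ i j, 1 ≤ i ∧ i ≤ k ∧ 1 ≤ j ∧ j ≤ k ∧ v ∈ fivePos n i j}

/-- The set of available ballot boxes determined by the grid-tiling sets `S`. -/
def Bset (k n : ℕ) (S : ℕ → ℕ → Set (ℕ × ℕ)) : Set (ℝ × ℝ) :=
  {x | ∃ i j p q, 1 ≤ i ∧ i ≤ k ∧ 1 ≤ j ∧ j ≤ k ∧ (p, q) ∈ S i j ∧ x = bbox n i j p q}

/-- The available ballot boxes of the cell `(i,j)`. -/
def Bij (n i j : ℕ) (S : ℕ → ℕ → Set (ℕ × ℕ)) : Set (ℝ × ℝ) :=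
  {x | ∃ p q, (p, q) ∈ S i j ∧ x = bbox n i j p q}

/-- The number of red voters voting at box `b` when the open boxes are `B'`:
`4·5^{(i-1)k+(j-1)} + 1` red voters sit at each center `c^{i,j}`. -/
def redCount (k n : ℕ) (B' : Set (ℝ × ℝ)) (b : ℝ × ℝ) : ℕ :=
  ∑ i ∈ Finset.Icc 1 k, ∑ j ∈ Finset.Icc 1 k,
    if nearestIn B' (cpos n i j) b then 4 * 5 ^ ((i - 1) * k + (j - 1)) + 1 else 0

/-- The number of blue voters voting at box `b` when the open boxes are `B'`:
`5^{(i-1)k+(j-1)}` blue voters sit at each of `V_←^{i,j}`, `V_→^{i,j}`,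
`V_↑^{i,j}`, `V_↓^{i,j}`. -/
def blueCount (k n : ℕ) (B' : Set (ℝ × ℝ)) (b : ℝ × ℝ) : ℕ :=
  ∑ i ∈ Finset.Icc 1 k, ∑ j ∈ Finset.Icc 1 k,
    ((if nearestIn B' (Vl n i j) b then 5 ^ ((i - 1) * k + (j - 1)) else 0) +
     (if nearestIn B' (Vr n i j) b then 5 ^ ((i - 1) * k + (j - 1)) else 0) +
     (if nearestIn B' (Vu n i j) b then 5 ^ ((i - 1) * k + (j - 1)) else 0) +
     (if nearestIn B' (Vd n i j) b then 5 ^ ((i - 1) * k + (j - 1)) else 0))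

/-- Red wins at box `b`: strictly more red than blue voters vote at `b`. -/
def redWins (k n : ℕ) (B' : Set (ℝ × ℝ)) (b : ℝ × ℝ) : Prop :=
  blueCount k n B' b < redCount k n B' b

/-- `s` is a solution of the grid-tiling instance `S`. -/
def IsGridSolution (k : ℕ) (S : ℕ → ℕ → Set (ℕ × ℕ)) (s : ℕ → ℕ → ℕ × ℕ) : Prop :=
  (∀ i j, 1 ≤ i → i ≤ k → 1 ≤ j → j ≤ k → s i j ∈ S i j) ∧
  (∀ i j, 1 ≤ i → i < k → 1 ≤ j → j ≤ k → (s i j).1 = (s (i + 1) j).1) ∧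
  (∀ i j, 1 ≤ i → i ≤ k → 1 ≤ j → j < k → (s i j).2 = (s i (j + 1)).2)
/-- The nearest box to a position is unique. -/
lemma nearestIn.unique {B' : Set (ℝ × ℝ)} {v b c : ℝ × ℝ}
    (hb : nearestIn B' v b) (hc : nearestIn B' v c) : b = c := by
  by_contra h
  exact lt_asymm (hb.2 c hc.1 (Ne.symm h)) (hc.2 b hb.1 h)

lemma edist2_lt_edist2_iff {a b c : ℝ × ℝ} :
    edist2 a b < edist2 a c ↔
      (a.1 - b.1) ^ 2 + (a.2 - b.2) ^ 2 < (a.1 - c.1) ^ 2 + (a.2 - c.2) ^ 2 :=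
  Real.sqrt_lt_sqrt_iff (by positivity)

/-- Weighted votes: if a cell `c` has four blue voters of weight `5 ^ e c` and red weight
`4 * 5 ^ e c + 1`, there are as many boxes as cells, and red wins at every box, then distinct
cells have their red voters at distinct boxes, and the blue voters vote with the red ones. -/
lemma injOn_and_blue_eq_red {ι β : Type*} (C : Finset ι) (T : Finset β) (e : ι → ℕ)
    (he : Set.InjOn e C) (hcard : T.card = C.card) (f : ι → β) (g : Fin 4 → ι → β)
    (hf : ∀ c ∈ C, f c ∈ T) (hg : ∀ t, ∀ c ∈ C, g t c ∈ T)
    (hwin : ∀ b ∈ T, (∑ c ∈ C, ∑ t, if g t c = b then 5 ^ e c else 0) <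
      ∑ c ∈ C, if f c = b then 4 * 5 ^ e c + 1 else 0) :
    Set.InjOn f C ∧ ∀ c ∈ C, ∀ t, g t c = f c := by
  have hsurj : ∀ b ∈ T, ∃ c ∈ C, f c = b := by
    intro b hb
    by_contra! h
    have h0 : ∑ c ∈ C, (if f c = b then 4 * 5 ^ e c + 1 else 0) = 0 :=
      Finset.sum_eq_zero fun c hc => if_neg (h c hc)
    exact absurd (hwin b hb) (by omega)
  have himage : C.image f = T := by
    ext b
    simp only [Finset.mem_image]
    exact ⟨fun ⟨c, hc, h⟩ => h ▸ hf c hc, hsurj b⟩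
  have hinj : Set.InjOn f C := Finset.card_image_iff.1 (by rw [himage, hcard])
  refine ⟨hinj, ?_⟩
  have hcap : ∀ c ∈ C, (∑ d ∈ C, ∑ t, if g t d = f c then 5 ^ e d else 0) ≤ 4 * 5 ^ e c := by
    intro c hc
    have hred : ∑ d ∈ C, (if f d = f c then 4 * 5 ^ e d + 1 else 0) = 4 * 5 ^ e c + 1 := by
      rw [Finset.sum_eq_single_of_mem c hc fun d hd hdc => if_neg fun h => hdc (hinj hd hc h),
        if_pos rfl]
    have := hwin _ (hf c hc)
    omega
  have hvote : ∀ c t b, g t c = b → 5 ^ e c ≤ ∑ t, if g t c = b then 5 ^ e c else 0 := by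
    intro c t b h
    have := Finset.single_le_sum (f := fun t => if g t c = b then 5 ^ e c else 0)
      (fun _ _ => Nat.zero_le _) (Finset.mem_univ t)
    simpa [h] using this
  intro c
  induction hm : C.sup e - e c using Nat.strong_induction_on generalizing c with
  | _ m ih =>
    intro hc t
    obtain ⟨d, hd, hfd⟩ := hsurj _ (hg t c hc)
    by_cases hdc : d = c
    · rw [← hfd, hdc]
    exfalso
    have hcv := hvote c t _ hfd.symm
    have hle := hcap d hd
    rcases lt_or_gt_of_ne fun h => hdc (he hd hc h) with hlt | hlt
    · have hsingle := Finset.single_le_sum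
        (f := fun c => ∑ t, if g t c = f d then 5 ^ e c else 0)
        (fun _ _ => Nat.zero_le _) hc
      have hpow : 5 ^ (e d + 1) ≤ 5 ^ e c := Nat.pow_le_pow_right (by norm_num) hlt
      have hpos : 0 < 5 ^ e d := by positivity
      rw [pow_succ] at hpow
      omega
    · have hsup : e d ≤ C.sup e := Finset.le_sup hd
      have hblue := ih _ (by omega) d rfl hd
      have hpair := Finset.sum_le_sum_of_subset (s := {d, c}) (t := C)
        (f := fun c => ∑ t, if g t c = f d then 5 ^ e c else 0)
        (by simp [Finset.insert_subset_iff, hc, hd])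
      rw [Finset.sum_pair hdc] at hpair
      have hfull : (∑ t, if g t d = f d then 5 ^ e d else 0) = 4 * 5 ^ e d := by
        simp [hblue]
      have hpos : 0 < 5 ^ e c := by positivity
      omega

/-- The numbering of the cells by the exponents is injective. -/
lemma exponent_injOn (k : ℕ) :
    Set.InjOn (fun c : ℕ × ℕ => (c.1 - 1) * k + (c.2 - 1))
      (Finset.Icc 1 k ×ˢ Finset.Icc 1 k : Finset (ℕ × ℕ)) := by
  rintro ⟨i, j⟩ hij ⟨i', j'⟩ hij' h
  simp only [Finset.coe_product, Finset.coe_Icc, Set.mem_prod, Set.mem_Icc] at hij hij' h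
  have hdiv : ∀ a b, b < k → (a * k + b) / k = a := by
    intro a b hb
    rw [mul_comm, Nat.mul_add_div (by omega), Nat.div_eq_of_lt hb, add_zero]
  have h1 : i - 1 = i' - 1 := by
    rw [← hdiv (i - 1) (j - 1) (by omega), h, hdiv _ _ (by omega)]
  rw [h1] at h
  ext <;> simp only <;> omega

/-- The four blue positions of the cell `(i,j)`. -/
def bluePos (n : ℕ) : Fin 4 → ℕ × ℕ → ℝ × ℝ :=
  ![fun c => Vl n c.1 c.2, fun c => Vr n c.1 c.2, fun c => Vu n c.1 c.2, fun c => Vd n c.1 c.2]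

/-- If red wins everywhere, each cell has its own box, at which all its voters vote. -/
lemma exists_cell_boxes {k n : ℕ} {B' : Set (ℝ × ℝ)} (hk : 1 ≤ k) (hcard : B'.ncard = k ^ 2)
    (hnear : ∀ v ∈ allPositions k n, ∃ b, nearestIn B' v b)
    (hwin : ∀ b ∈ B', redWins k n B' b) :
    ∃ f : ℕ × ℕ → ℝ × ℝ,
      Set.InjOn f (Finset.Icc 1 k ×ˢ Finset.Icc 1 k : Finset (ℕ × ℕ)) ∧
      ∀ c ∈ Finset.Icc 1 k ×ˢ Finset.Icc 1 k, ∀ v ∈ fivePos n c.1 c.2, nearestIn B' v (f c) := by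
  have hfin : B'.Finite := Set.finite_of_ncard_pos (by rw [hcard]; positivity)
  choose! box hbox using hnear
  set C := Finset.Icc 1 k ×ˢ Finset.Icc 1 k with hC
  have hpos : ∀ c ∈ C, ∀ v ∈ fivePos n c.1 c.2, nearestIn B' v (box v) := by
    rintro ⟨i, j⟩ hc v hv
    simp only [hC, Finset.mem_product, Finset.mem_Icc] at hc
    exact hbox v ⟨i, j, hc.1.1, hc.1.2, hc.2.1, hc.2.2, hv⟩
  have hiff : ∀ c ∈ C, ∀ v ∈ fivePos n c.1 c.2, ∀ b, nearestIn B' v b ↔ box v = b :=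
    fun c hc v hv b => ⟨fun h => (hpos c hc v hv).unique h, fun h => h ▸ hpos c hc v hv⟩
  have hblue : ∀ t c, bluePos n t c ∈ fivePos n c.1 c.2 := by
    intro t c
    fin_cases t <;> simp [bluePos, fivePos]
  have hcenter : ∀ c : ℕ × ℕ, cpos n c.1 c.2 ∈ fivePos n c.1 c.2 := fun c => by simp [fivePos]
  obtain ⟨hinj, heq⟩ := injOn_and_blue_eq_red C hfin.toFinset _ (exponent_injOn k)
    (by rw [← Set.ncard_eq_toFinset_card _ hfin, hcard, hC]; simp [sq])
    (fun c => box (cpos n c.1 c.2)) (fun t c => box (bluePos n t c))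
    (fun c hc => hfin.mem_toFinset.2 (hpos c hc _ (hcenter c)).1)
    (fun t c hc => hfin.mem_toFinset.2 (hpos c hc _ (hblue t c)).1)
    (by
      intro b hb
      have h := hwin b (hfin.mem_toFinset.1 hb)
      unfold redWins blueCount redCount at h
      rw [← Finset.sum_product', ← Finset.sum_product', ← hC] at h
      convert h using 1
      · refine Finset.sum_congr rfl fun c hc => ?_
        have h4 := fun t => hiff c hc _ (hblue t c) b
        simp only [Fin.sum_univ_four, ← h4]
        simp [bluePos]
      · refine Finset.sum_congr rfl fun c hc => ?_
        simp only [← hiff c hc _ (hcenter c) b])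
  refine ⟨fun c => box (cpos n c.1 c.2), hinj, fun c hc v hv => (hiff c hc v hv _).2 ?_⟩
  have h4 := heq c hc
  simp only [fivePos, Set.mem_insert_iff, Set.mem_singleton_iff] at hv
  rcases hv with rfl | rfl | rfl | rfl | rfl
  · rfl
  · exact h4 0
  · exact h4 1
  · exact h4 2
  · exact h4 3

/-- The offset of a box coordinate from the lower end of the box region of its cell. -/
def boxOffset (n i p : ℕ) : ℝ := if Even i then 4 * (p : ℝ) else 4 * ((n : ℝ) - p)

lemma bbox_eq (n i j p q : ℕ) :
    bbox n i j p q = (Lc n * ((i : ℝ) - 1) + 5 * (n : ℝ) ^ 2 + boxOffset n i p,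
      Lc n * ((j : ℝ) - 1) + 5 * (n : ℝ) ^ 2 + boxOffset n j q) := by
  unfold bbox boxOffset
  ext <;> simp only <;> split_ifs <;> rfl

lemma boxOffset_mem {n p : ℕ} (i : ℕ) (hp : p ≤ n) :
    0 ≤ boxOffset n i p ∧ boxOffset n i p ≤ 4 * n := by
  have : (p : ℝ) ≤ n := by exact_mod_cast hp
  have : (0 : ℝ) ≤ p := by positivity
  unfold boxOffset
  split_ifs <;> constructor <;> linarith

/-- An affine function which is negative at the vertices of a diamond is negative inside. -/
lemma affine_neg_of_diamond {a gx gy r x y : ℝ} (h1 : a - r * gx < 0) (h2 : a + r * gx < 0)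
    (h3 : a - r * gy < 0) (h4 : a + r * gy < 0) (hr : 0 < r) (hxy : |x| + |y| ≤ r) :
    a + x * gx + y * gy < 0 := by
  have hx : r * |gx| < -a := by
    rcases abs_cases gx with ⟨h, -⟩ | ⟨h, -⟩ <;> rw [h] <;> linarith
  have hy : r * |gy| < -a := by
    rcases abs_cases gy with ⟨h, -⟩ | ⟨h, -⟩ <;> rw [h] <;> linarith
  have hxg : x * gx ≤ |x| * |gx| := (le_abs_self _).trans (abs_mul x gx).le
  have hyg : y * gy ≤ |y| * |gy| := (le_abs_self _).trans (abs_mul y gy).le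
  have hmain : r * (|x| * |gx| + |y| * |gy|) < r * -a := by
    have ha : 0 < -a := lt_of_le_of_lt (by positivity) hx
    by_cases hz : |x| + |y| = 0
    · have hx0 : |x| = 0 := by linarith [abs_nonneg x, abs_nonneg y]
      have hy0 : |y| = 0 := by linarith [abs_nonneg x, abs_nonneg y]
      simp only [hx0, hy0, zero_mul, add_zero, mul_zero]
      positivity
    have hs : 0 < |x| + |y| := lt_of_le_of_ne (by positivity) (Ne.symm hz)
    have hbound : |x| * (r * |gx|) + |y| * (r * |gy|) < (|x| + |y|) * -a := by
      rcases (abs_nonneg x).eq_or_lt with h | h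
      · rw [← h] at hs ⊢
        nlinarith
      · nlinarith [mul_lt_mul_of_pos_left hx h, mul_le_mul_of_nonneg_left hy.le (abs_nonneg y)]
    nlinarith
  have := lt_of_mul_lt_mul_left hmain hr.le
  linarith

/-- The four vertices of a diamond centred at `(X, Y)` cannot all be closer to `(b₁, b₂)` than
to the point `(X + x, Y + y)` of the diamond. -/
lemma not_closer_to_vertices {X Y x y b₁ b₂ r : ℝ} (hr : 0 < r) (hxy : |x| + |y| ≤ r)
    (hl : (X - r - b₁) ^ 2 + (Y - b₂) ^ 2 < (-r - x) ^ 2 + (-y) ^ 2)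
    (hr' : (X + r - b₁) ^ 2 + (Y - b₂) ^ 2 < (r - x) ^ 2 + (-y) ^ 2)
    (hu : (X - b₁) ^ 2 + (Y - r - b₂) ^ 2 < (-x) ^ 2 + (-r - y) ^ 2)
    (hd : (X - b₁) ^ 2 + (Y + r - b₂) ^ 2 < (-x) ^ 2 + (r - y) ^ 2) : False := by
  have key := affine_neg_of_diamond (a := (X - b₁) ^ 2 + (Y - b₂) ^ 2 - x ^ 2 - y ^ 2)
    (gx := 2 * (X + x - b₁)) (gy := 2 * (Y + y - b₂))
    (by linear_combination hl) (by linear_combination hr')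
    (by linear_combination hu) (by linear_combination hd) hr hxy
  have hsq : 0 ≤ (X + x - b₁) ^ 2 + (Y + y - b₂) ^ 2 := by positivity
  linarith

/-- A box nearest to all voter positions of a cell equals every open box of that cell. -/
lemma eq_of_nearestIn_fivePos {n i j p q : ℕ} {B' : Set (ℝ × ℝ)} {b : ℝ × ℝ} (hn : 1 ≤ n)
    (hp : p ≤ n) (hq : q ≤ n) (hmem : bbox n i j p q ∈ B')
    (hb : ∀ v ∈ fivePos n i j, nearestIn B' v b) : bbox n i j p q = b := by
  by_contra hne
  have hlt := fun v hv => edist2_lt_edist2_iff.1 ((hb v hv).2 _ hmem hne)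
  have hl := hlt (Vl n i j) (by simp [fivePos])
  have hr := hlt (Vr n i j) (by simp [fivePos])
  have hu := hlt (Vu n i j) (by simp [fivePos])
  have hd := hlt (Vd n i j) (by simp [fivePos])
  have hn1 : (1 : ℝ) ≤ n := by exact_mod_cast hn
  obtain ⟨hx0, hx1⟩ := boxOffset_mem i hp
  obtain ⟨hy0, hy1⟩ := boxOffset_mem j hq
  have hx : |boxOffset n i p - 2 * n| ≤ 2 * n := abs_le.2 ⟨by linarith, by linarith⟩
  have hy : |boxOffset n j q - 2 * n| ≤ 2 * n := abs_le.2 ⟨by linarith, by linarith⟩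
  simp only [bbox_eq, Vl, Vr, Vu, Vd, Lc] at hl hr hu hd
  refine not_closer_to_vertices (r := 5 * (n : ℝ) ^ 2 + 2 * n - 1)
    (X := (cpos n i j).1) (Y := (cpos n i j).2) (b₁ := b.1) (b₂ := b.2)
    (by nlinarith) ((add_le_add hx hy).trans (by nlinarith)) ?_ ?_ ?_ ?_ <;>
    simp only [cpos, Lc]
  · convert hl using 3 <;> ring
  · convert hr using 3 <;> ring
  · convert hu using 3 <;> ring
  · convert hd using 3 <;> ring

/-- Boxes of two consecutive cells separated by the line at `Lc n * i`, each preferred by the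
voter next to this line on its own side, have the same index in the direction across the line. -/
lemma index_eq_of_adjacent {n i p p' : ℕ} {d d' : ℝ} (hn : 1 ≤ n) (hp : p ≤ n) (hp' : p' ≤ n)
    (hd0 : 0 ≤ d) (hd1 : d ≤ 4 * (n : ℝ) ^ 2) (hd0' : 0 ≤ d') (hd1' : d' ≤ 4 * (n : ℝ) ^ 2)
    (h : (Lc n * i - 1 - (Lc n * ((i : ℝ) - 1) + 5 * (n : ℝ) ^ 2 + boxOffset n i p)) ^ 2 + d <
      (Lc n * i - 1 - (Lc n * i + 5 * (n : ℝ) ^ 2 + boxOffset n (i + 1) p')) ^ 2 + d')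
    (h' : (Lc n * i + 1 - (Lc n * i + 5 * (n : ℝ) ^ 2 + boxOffset n (i + 1) p')) ^ 2 + d' <
      (Lc n * i + 1 - (Lc n * ((i : ℝ) - 1) + 5 * (n : ℝ) ^ 2 + boxOffset n i p)) ^ 2 + d) :
    p = p' := by
  have hn1 : (1 : ℝ) ≤ n := by exact_mod_cast hn
  have hgap : ∀ u u' e e' : ℝ, 0 ≤ u → 0 ≤ u' → 0 ≤ e → e' ≤ 4 * (n : ℝ) ^ 2 →
      (5 * (n : ℝ) ^ 2 + u - 1) ^ 2 + e < (5 * (n : ℝ) ^ 2 + u' + 1) ^ 2 + e' → u < u' + 4 := by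
    intro u u' e e' hu hu' he he' hlt
    by_contra! hge
    nlinarith [mul_nonneg (sub_nonneg.2 hge) (by positivity : 0 ≤ 10 * (n : ℝ) ^ 2 + u + u')]
  obtain ⟨ho0, ho1⟩ := boxOffset_mem i hp
  obtain ⟨ho0', ho1'⟩ := boxOffset_mem (i + 1) hp'
  have hlt := hgap (4 * n - boxOffset n i p) (boxOffset n (i + 1) p') d d' (by linarith) ho0'
    hd0 hd1' (by unfold Lc at h; linear_combination h)
  have hgt := hgap (boxOffset n (i + 1) p') (4 * n - boxOffset n i p) d' d ho0' (by linarith)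
    hd0' hd1 (by unfold Lc at h'; linear_combination h')
  have hlt1 : (p : ℝ) < p' + 1 ∧ (p' : ℝ) < p + 1 := by
    by_cases hi : Even i
    · have hi' : ¬ Even (i + 1) := by simpa [Nat.even_add_one] using hi
      simp only [boxOffset, hi, hi', if_true, if_false] at hlt hgt
      constructor <;> linarith
    · have hi' : Even (i + 1) := by simpa [Nat.even_add_one] using hi
      simp only [boxOffset, hi, hi', if_true, if_false] at hlt hgt
      constructor <;> linarith
  have h1 : p < p' + 1 := by exact_mod_cast hlt1.1
  have h2 : p' < p + 1 := by exact_mod_cast hlt1.2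
  omega

lemma sq_boxOffset_sub_le {n p : ℕ} (i : ℕ) (hp : p ≤ n) :
    (2 * (n : ℝ) - boxOffset n i p) ^ 2 ≤ 4 * (n : ℝ) ^ 2 := by
  obtain ⟨h0, h1⟩ := boxOffset_mem i hp
  nlinarith

lemma bbox_ne_of_right {n i j p q p' q' : ℕ} (hn : 1 ≤ n) (hp : p ≤ n) (hp' : p' ≤ n) :
    bbox n i j p q ≠ bbox n (i + 1) j p' q' := by
  intro h
  have h1 := congrArg Prod.fst h
  have hn1 : (1 : ℝ) ≤ n := by exact_mod_cast hn
  obtain ⟨-, ho1⟩ := boxOffset_mem i hp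
  obtain ⟨ho0', -⟩ := boxOffset_mem (i + 1) hp'
  simp only [bbox_eq, Lc] at h1
  push_cast at h1
  nlinarith

lemma bbox_ne_of_below {n i j p q p' q' : ℕ} (hn : 1 ≤ n) (hq : q ≤ n) (hq' : q' ≤ n) :
    bbox n i j p q ≠ bbox n i (j + 1) p' q' := by
  intro h
  have h1 := congrArg Prod.snd h
  have hn1 : (1 : ℝ) ≤ n := by exact_mod_cast hn
  obtain ⟨-, ho1⟩ := boxOffset_mem j hq
  obtain ⟨ho0', -⟩ := boxOffset_mem (j + 1) hq'
  simp only [bbox_eq, Lc] at h1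
  push_cast at h1
  nlinarith

/-- Horizontally adjacent selected boxes have equal first index. -/
lemma fst_eq_of_adjacent {n i j p q p' q' : ℕ} {B' : Set (ℝ × ℝ)} (hn : 1 ≤ n)
    (hp : p ≤ n) (hq : q ≤ n) (hp' : p' ≤ n) (hq' : q' ≤ n)
    (h : nearestIn B' (Vr n i j) (bbox n i j p q))
    (h' : nearestIn B' (Vl n (i + 1) j) (bbox n (i + 1) j p' q')) : p = p' := by
  have hne := bbox_ne_of_right (j := j) (i := i) (q := q) (q' := q') hn hp hp'
  have h1 := edist2_lt_edist2_iff.1 (h.2 _ h'.1 hne.symm)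
  have h2 := edist2_lt_edist2_iff.1 (h'.2 _ h.1 hne)
  simp only [bbox_eq, Vl, Vr, Nat.cast_add, Nat.cast_one, add_sub_cancel_right,
    add_sub_add_left_eq_sub] at h1 h2
  exact index_eq_of_adjacent hn hp hp' (sq_nonneg _) (sq_boxOffset_sub_le j hq)
    (sq_nonneg _) (sq_boxOffset_sub_le j hq') h1 h2

/-- Vertically adjacent selected boxes have equal second index. -/
lemma snd_eq_of_adjacent {n i j p q p' q' : ℕ} {B' : Set (ℝ × ℝ)} (hn : 1 ≤ n)
    (hp : p ≤ n) (hq : q ≤ n) (hp' : p' ≤ n) (hq' : q' ≤ n)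
    (h : nearestIn B' (Vd n i j) (bbox n i j p q))
    (h' : nearestIn B' (Vu n i (j + 1)) (bbox n i (j + 1) p' q')) : q = q' := by
  have hne := bbox_ne_of_below (j := j) (i := i) (p := p) (p' := p') hn hq hq'
  have h1 := edist2_lt_edist2_iff.1 (h.2 _ h'.1 hne.symm)
  have h2 := edist2_lt_edist2_iff.1 (h'.2 _ h.1 hne)
  simp only [bbox_eq, Vu, Vd, Nat.cast_add, Nat.cast_one, add_sub_cancel_right,
    add_sub_add_left_eq_sub] at h1 h2
  exact index_eq_of_adjacent (i := j) hn hq hq' (sq_nonneg _) (sq_boxOffset_sub_le i hp)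
    (sq_nonneg _) (sq_boxOffset_sub_le i hp') (by linarith only [h1])
    (by linarith only [h2])

/-- Reverse direction of the reduction: if `B' ⊆ B` has `k²` boxes, every voter
position has a unique nearest box of `B'`, and red wins at every box of `B'`,
then `B'` selects exactly one box `b^{i,j}_{s_{i,j}}` in each `B_{i,j}`, the
voters voting at this box are exactly those at the five positions of cell
`(i,j)`, and the selected pairs `s_{i,j}` form a grid-tiling solution. -/
theorem win_gives_grid_solution (k n : ℕ) (hk : 1 ≤ k) (hn : 1 ≤ n)
    (S : ℕ → ℕ → Set (ℕ × ℕ))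
    (hSsub : ∀ i j, 1 ≤ i → i ≤ k → 1 ≤ j → j ≤ k →
      ∀ pq ∈ S i j, 1 ≤ pq.1 ∧ pq.1 ≤ n ∧ 1 ≤ pq.2 ∧ pq.2 ≤ n)
    (hSne : ∀ i j, 1 ≤ i → i ≤ k → 1 ≤ j → j ≤ k → (S i j).Nonempty)
    (B' : Set (ℝ × ℝ)) (hBsub : B' ⊆ Bset k n S) (hcard : B'.ncard = k ^ 2)
    (hnear : ∀ v ∈ allPositions k n, ∃ b, nearestIn B' v b)
    (hwin : ∀ b ∈ B', redWins k n B' b) :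
    ∃ s : ℕ → ℕ → ℕ × ℕ, IsGridSolution k S s ∧
      ∀ i j, 1 ≤ i → i ≤ k → 1 ≤ j → j ≤ k →
        (B' ∩ Bij n i j S = {bbox n i j (s i j).1 (s i j).2}) ∧
        (∀ v ∈ fivePos n i j, nearestIn B' v (bbox n i j (s i j).1 (s i j).2)) ∧
        (∀ i' j', 1 ≤ i' → i' ≤ k → 1 ≤ j' → j' ≤ k → (i', j') ≠ (i, j) →
          ∀ v ∈ fivePos n i' j',
            ¬ nearestIn B' v (bbox n i j (s i j).1 (s i j).2)) := by
  obtain ⟨f, hinj, hvote⟩ := exists_cell_boxes hk hcard hnear hwin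
  have hcell : ∀ {i j}, 1 ≤ i → i ≤ k → 1 ≤ j → j ≤ k →
      (i, j) ∈ Finset.Icc 1 k ×ˢ Finset.Icc 1 k := by
    intro i j hi hik hj hjk
    simp [hi, hik, hj, hjk]
  have howner : ∀ i j p q, 1 ≤ i → i ≤ k → 1 ≤ j → j ≤ k → (p, q) ∈ S i j →
      bbox n i j p q ∈ B' → bbox n i j p q = f (i, j) := by
    intro i j p q hi hik hj hjk hS hmem
    obtain ⟨-, hp, -, hq⟩ := hSsub i j hi hik hj hjk _ hS
    exact eq_of_nearestIn_fivePos hn hp hq hmem (hvote _ (hcell hi hik hj hjk))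
  have hsel : ∀ i j, ∃ pq : ℕ × ℕ, 1 ≤ i → i ≤ k → 1 ≤ j → j ≤ k →
      pq ∈ S i j ∧ bbox n i j pq.1 pq.2 = f (i, j) := by
    intro i j
    by_cases hij : (1 ≤ i ∧ i ≤ k) ∧ 1 ≤ j ∧ j ≤ k
    · obtain ⟨⟨hi, hik⟩, hj, hjk⟩ := hij
      have hmem : f (i, j) ∈ B' :=
        (hvote _ (hcell hi hik hj hjk) (cpos n i j) (by simp [fivePos])).1
      obtain ⟨i', j', p, q, hi', hik', hj', hjk', hS, heq⟩ := hBsub hmem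
      have hown := howner i' j' p q hi' hik' hj' hjk' hS (heq ▸ hmem)
      have hcc : (i, j) = (i', j') :=
        hinj (hcell hi hik hj hjk) (hcell hi' hik' hj' hjk') (heq.trans hown)
      obtain ⟨rfl, rfl⟩ := Prod.mk.inj hcc
      exact ⟨(p, q), fun _ _ _ _ => ⟨hS, heq.symm⟩⟩
    · exact ⟨(0, 0), fun hi hik hj hjk => absurd ⟨⟨hi, hik⟩, hj, hjk⟩ hij⟩
  choose s hs using hsel
  have hnearest : ∀ i j, 1 ≤ i → i ≤ k → 1 ≤ j → j ≤ k →
      ∀ v ∈ fivePos n i j, nearestIn B' v (bbox n i j (s i j).1 (s i j).2) := by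
    intro i j hi hik hj hjk v hv
    rw [(hs i j hi hik hj hjk).2]
    exact hvote _ (hcell hi hik hj hjk) v hv
  have hle : ∀ i j, 1 ≤ i → i ≤ k → 1 ≤ j → j ≤ k → (s i j).1 ≤ n ∧ (s i j).2 ≤ n := by
    intro i j hi hik hj hjk
    obtain ⟨-, hp, -, hq⟩ := hSsub i j hi hik hj hjk _ (hs i j hi hik hj hjk).1
    exact ⟨hp, hq⟩
  refine ⟨s, ⟨fun i j hi hik hj hjk => (hs i j hi hik hj hjk).1, ?_, ?_⟩, ?_⟩
  · intro i j hi hik hj hjk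
    obtain ⟨hp, hq⟩ := hle i j hi hik.le hj hjk
    obtain ⟨hp', hq'⟩ := hle (i + 1) j (by omega) hik hj hjk
    exact fst_eq_of_adjacent hn hp hq hp' hq'
      (hnearest i j hi hik.le hj hjk _ (by simp [fivePos]))
      (hnearest (i + 1) j (by omega) hik hj hjk _ (by simp [fivePos]))
  · intro i j hi hik hj hjk
    obtain ⟨hp, hq⟩ := hle i j hi hik hj hjk.le
    obtain ⟨hp', hq'⟩ := hle i (j + 1) hi hik (by omega) hjk
    exact snd_eq_of_adjacent hn hp hq hp' hq'
      (hnearest i j hi hik hj hjk.le _ (by simp [fivePos]))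
      (hnearest i (j + 1) hi hik (by omega) hjk _ (by simp [fivePos]))
  · intro i j hi hik hj hjk
    refine ⟨?_, hnearest i j hi hik hj hjk, ?_⟩
    · ext x
      simp only [Set.mem_inter_iff, Set.mem_singleton_iff]
      constructor
      · rintro ⟨hx, p, q, hS, rfl⟩
        rw [howner i j p q hi hik hj hjk hS hx, (hs i j hi hik hj hjk).2]
      · rintro rfl
        exact ⟨(hnearest i j hi hik hj hjk (cpos n i j) (by simp [fivePos])).1,
          _, _, (hs i j hi hik hj hjk).1, rfl⟩
    · intro i' j' hi' hik' hj' hjk' hne v hv hv'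
      rw [(hs i j hi hik hj hjk).2] at hv'
      exact hne (hinj (hcell hi' hik' hj' hjk') (hcell hi hik hj hjk)
        ((hvote _ (hcell hi' hik' hj' hjk') v hv).unique hv'))
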